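/- Let n ≥ 2, X, Y ∈ 𝕎^n, k ∈ {1,…,n}, and σ ∈ S_n with σ(1) = k, and let τ = φ_k(σ) ∈ S_{n−1}. If x_1 = y_1 = y_2 = ⋯ = y_k, then Λ_Y(X;0;σ) = q^{k−1} · Λ_{(y_2,…,y_n)}((x_2,…,x_n);0;τ), where the right-hand side is the (n−1)-particle quantity Λ for the truncated vectors. -/

import Mathlib

/-- Extended product `∏'_{k=m}^{n} f k`. -/
noncomputable def eprod (f : ℤ → ℂ) (m n : ℤ) : ℂ :=
  if m ≤ n + 1 then ∏ k ∈ Finset.Icc m n, f k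
  else ∏ k ∈ Finset.Icc (n + 1) (m - 1), (f k)⁻¹

/-- `A_σ(w_1,…,w_n)`: product of `S_{(β,α)}` over inversions `(β,α)` of `σ`. -/
noncomputable def Acoef (q : ℝ) {n : ℕ} (σ : Equiv.Perm (Fin n)) (w : Fin n → ℂ) : ℂ :=
  ∏ p ∈ Finset.univ.filter
      (fun p : Fin n × Fin n => p.2 < p.1 ∧ σ⁻¹ p.1 < σ⁻¹ p.2),
    (-((q : ℂ) * w p.1 - w p.2) / ((q : ℂ) * w p.2 - w p.1))

/-- `B(w_1,…,w_n) = ∏_{i<j} (w_i - w_j)/(w_i - q w_j)`. -/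
noncomputable def Bcoef (q : ℝ) {n : ℕ} (w : Fin n → ℂ) : ℂ :=
  ∏ p ∈ Finset.univ.filter (fun p : Fin n × Fin n => p.1 < p.2),
    (w p.1 - w p.2) / (w p.1 - (q : ℂ) * w p.2)

/-- Iterated contour integral over `n` counterclockwise circles of radius `R` centred at `0`,
outermost variable first. -/
noncomputable def mcInt : (n : ℕ) → ℝ → ((Fin n → ℂ) → ℂ) → ℂ
  | 0, _, f => f (fun i => i.elim0)
  | n + 1, R, f => ∮ z in C(0, R), mcInt n R (fun w => f (Fin.cons z w))

/-- `Λ_Y(X;t;σ)`, with all contours the counterclockwise circle of radius `R`. -/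
noncomputable def Lam (q : ℝ) (b : ℤ → ℝ) {n : ℕ} (Y X : Fin n → ℤ)
    (t : ℝ) (σ : Equiv.Perm (Fin n)) (R : ℝ) : ℂ :=
  (∏ k, (-1 : ℂ) / (b (X k) : ℂ)) * (1 / (2 * Real.pi * Complex.I)) ^ n *
    mcInt n R (fun w =>
      Acoef q σ w *
        ∏ j, (eprod (fun k => (b k : ℂ) / ((b k : ℂ) - w (σ j))) (Y (σ j)) (X j) *
          Complex.exp (-(w j) * (t : ℂ))))

/-- `R` is a valid contour radius for `Λ_Y(X;·;·)`: `R > b k` for every integer `k` in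
`[min_j min(x_j, y_j) - 1, max_j max(x_j, y_j)]`. -/
def ValidR (b : ℤ → ℝ) {n : ℕ} (X Y : Fin n → ℤ) (R : ℝ) : Prop :=
  ∀ k : ℤ, (∃ j, min (X j) (Y j) - 1 ≤ k) → (∃ j, k ≤ max (X j) (Y j)) → b k < R

/-- Number of coordinates of `X` equal to `s`. -/
def cnt {n : ℕ} (X : Fin n → ℤ) (s : ℤ) : ℕ :=
  (Finset.univ.filter (fun j => X j = s)).card

/-- The `q`-deformed factorial `[k]_q! = ∏_{j=1}^{k} (1-q^j)/(1-q)`. -/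
noncomputable def qfac (q : ℝ) (k : ℕ) : ℝ :=
  ∏ j ∈ Finset.Icc 1 k, (1 - q ^ j) / (1 - q)

/-- `W(X) = ∏_i [k_i]_q!` over the distinct values of `X` with multiplicities `k_i`. -/
noncomputable def Wcoef (q : ℝ) {n : ℕ} (X : Fin n → ℤ) : ℝ :=
  ∏ s ∈ Finset.univ.image X, qfac q (cnt X s)

/-- For `X` weakly decreasing, `lowerLast X s = X^{K,-}` where the coordinate lowered by `1`
is the last one equal to `s`. -/
def lowerLast {n : ℕ} (X : Fin n → ℤ) (s : ℤ) : Fin n → ℤ :=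
  fun j => if X j = s ∧ ∀ i, j < i → X i ≠ s then X j - 1 else X j

/-- The `q`-TAZRP master equation for a family `P(X;·)`, `X ∈ 𝕎^n`. -/
def MasterEq (q : ℝ) (a : ℤ → ℝ) {n : ℕ} (P : (Fin n → ℤ) → ℝ → ℂ) : Prop :=
  ∀ X : Fin n → ℤ, Antitone X → ∀ t : ℝ, 0 ≤ t →
    HasDerivAt (P X)
      ((∑ s ∈ Finset.univ.image X,
          (1 - (q : ℂ) ^ cnt (lowerLast X s) (s - 1)) * (a (s - 1) : ℂ) * P (lowerLast X s) t) -
        ∑ s ∈ Finset.univ.image X,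
          (1 - (q : ℂ) ^ cnt X s) * (a s : ℂ) * P X t) t

/-- The tuple `X` with coordinates `k` and `k+1` (0-based) replaced by `u` and `v`. -/
def set2 {n : ℕ} (X : Fin n → ℤ) (k : ℕ) (h : k + 1 < n) (u v : ℤ) : Fin n → ℤ :=
  Function.update (Function.update X ⟨k, by omega⟩ u) ⟨k + 1, h⟩ v

/-- The free particle evolution equation. -/
def FreeEvol (b : ℤ → ℝ) {n : ℕ} (u : (Fin n → ℤ) → ℝ → ℂ) : Prop :=
  ∀ X : Fin n → ℤ, ∀ t : ℝ, 0 ≤ t →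
    HasDerivAt (u X)
      (∑ k, ((b (X k - 1) : ℂ) * u (Function.update X k (X k - 1)) t -
        (b (X k) : ℂ) * u X t)) t

/-- The boundary conditions. -/
def BoundaryCond (q : ℝ) (b : ℤ → ℝ) {n : ℕ} (u : (Fin n → ℤ) → ℝ → ℂ) : Prop :=
  ∀ (k : ℕ) (h : k + 1 < n) (X : Fin n → ℤ) (x : ℤ) (t : ℝ), 0 ≤ t →
    (b (x - 1) : ℂ) * u (set2 X k h (x - 1) x) t =
      (q : ℂ) * (b (x - 1) : ℂ) * u (set2 X k h x (x - 1)) t +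
        (1 - (q : ℂ)) * (b x : ℂ) * u (set2 X k h x x) t

/-- The explicit one-particle transition probability. -/
noncomputable def P1 (b : ℤ → ℝ) (y x : ℤ) (t : ℝ) : ℝ :=
  if x < y then 0
  else if x = y then Real.exp (-(b y) * t)
  else (∏ k ∈ Finset.Icc y (x - 1), b k) *
    ∑ k ∈ Finset.Icc y x,
      (∏ j ∈ (Finset.Icc y x).erase k, (b j - b k)⁻¹) * Real.exp (-(b k) * t)

section ContourIntegral

variable {n : ℕ}

lemma continuous_circleIntegral {P : Type*} [TopologicalSpace P] [FirstCountableTopology P]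
    (r : ℝ) {G : P → ℂ → ℂ} (hG : Continuous fun p : P × ℝ => G p.1 (circleMap 0 r p.2)) :
    Continuous fun p => ∮ z in C(0, r), G p z := by
  unfold circleIntegral
  apply intervalIntegral.continuous_parametric_intervalIntegral_of_continuous'
  simp only [deriv_circleMap]
  change Continuous fun p : P × ℝ => (circleMap 0 r p.2 * Complex.I) • G p.1 (circleMap 0 r p.2)
  exact (by fun_prop : Continuous fun p : P × ℝ => circleMap 0 r p.2 * Complex.I).smul hG

lemma cons_circleMap (R θ : ℝ) (φ : Fin n → ℝ) :
    (Fin.cons (circleMap 0 R θ) (fun i => circleMap 0 R (φ i)) : Fin (n + 1) → ℂ) =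
      fun i => circleMap 0 R ((Fin.cons θ φ : Fin (n + 1) → ℝ) i) := by
  ext i
  refine Fin.cases ?_ (fun i => ?_) i <;> simp

lemma continuous_mcInt {P : Type} [TopologicalSpace P] [FirstCountableTopology P] (R : ℝ)
    {G : P → (Fin n → ℂ) → ℂ}
    (hG : Continuous fun p : P × (Fin n → ℝ) => G p.1 fun i => circleMap 0 R (p.2 i)) :
    Continuous fun p => mcInt n R (G p) := by
  induction n generalizing P with
  | zero =>
    have h : Continuous fun p : P => (p, (fun i => i.elim0 : Fin 0 → ℝ)) := by fun_prop
    convert hG.comp h using 2 with p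
    simp only [mcInt, Function.comp_apply]
    congr 1
    ext i
    exact i.elim0
  | succ n ih =>
    simp only [mcInt]
    refine continuous_circleIntegral R
      (G := fun p z => mcInt n R fun w => G p (Fin.cons z w)) ?_
    refine ih (P := P × ℝ) (G := fun p w => G p.1 (Fin.cons (circleMap 0 R p.2) w)) ?_
    have h : Continuous fun p : (P × ℝ) × (Fin n → ℝ) =>
        (p.1.1, (Fin.cons p.1.2 p.2 : Fin (n + 1) → ℝ)) := by fun_prop
    convert hG.comp h using 2 with p
    simp only [Function.comp_apply, cons_circleMap]

lemma circleIntegral_swap (r s : ℝ) {f : ℂ → ℂ → ℂ}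
    (hf : Continuous fun p : ℝ × ℝ => f (circleMap 0 r p.1) (circleMap 0 s p.2)) :
    (∮ z in C(0, r), ∮ x in C(0, s), f z x) = ∮ x in C(0, s), ∮ z in C(0, r), f z x := by
  simp only [circleIntegral, deriv_circleMap, ← intervalIntegral.integral_smul]
  rw [MeasureTheory.intervalIntegral_intervalIntegral_swap]
  · refine intervalIntegral.integral_congr fun φ _ => intervalIntegral.integral_congr fun θ _ => ?_
    exact smul_comm _ _ _
  · have h : Continuous (Function.uncurry fun θ φ : ℝ =>
        (circleMap 0 r θ * Complex.I) • (circleMap 0 s φ * Complex.I) •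
          f (circleMap 0 r θ) (circleMap 0 s φ)) := by
      simp only [Function.uncurry_def]
      exact (by fun_prop : Continuous fun p : ℝ × ℝ => circleMap 0 r p.1 * Complex.I).smul
        ((by fun_prop : Continuous fun p : ℝ × ℝ => circleMap 0 s p.2 * Complex.I).smul hf)
    exact (h.continuousOn.integrableOn_compact (isCompact_uIcc.prod isCompact_uIcc)).mono_set
      (Set.prod_mono Set.uIoc_subset_uIcc Set.uIoc_subset_uIcc)

lemma circleIntegral_mcInt_swap (r R : ℝ) {f : ℂ → (Fin n → ℂ) → ℂ}
    (hf : Continuous fun p : ℝ × (Fin n → ℝ) =>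
      f (circleMap 0 r p.1) fun i => circleMap 0 R (p.2 i)) :
    (∮ z in C(0, r), mcInt n R (f z)) = mcInt n R fun w => ∮ z in C(0, r), f z w := by
  induction n with
  | zero => rfl
  | succ n ih =>
    have hcons : Continuous fun p : (ℝ × ℝ) × (Fin n → ℝ) =>
        (p.1.1, (Fin.cons p.1.2 p.2 : Fin (n + 1) → ℝ)) := by fun_prop
    have h := hf.comp hcons
    simp only [Function.comp_def, ← cons_circleMap] at h
    simp only [mcInt]
    rw [circleIntegral_swap r R (f := fun z x => mcInt n R fun w => f z (Fin.cons x w))]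
    · unfold circleIntegral
      refine intervalIntegral.integral_congr fun θ _ => ?_
      have hθ : Continuous fun p : ℝ × (Fin n → ℝ) => ((p.1, θ), p.2) := by fun_prop
      simp only
      congr 1
      exact ih (f := fun z w => f z (Fin.cons (circleMap 0 R θ) w)) (h.comp hθ)
    · exact continuous_mcInt (P := ℝ × ℝ) R
        (G := fun p w => f (circleMap 0 r p.1) (Fin.cons (circleMap 0 R p.2) w)) h

lemma mcInt_congr {R : ℝ} (hR : 0 ≤ R) {f g : (Fin n → ℂ) → ℂ}
    (h : ∀ w, (∀ i, ‖w i‖ = R) → f w = g w) : mcInt n R f = mcInt n R g := by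
  induction n with
  | zero => exact h _ fun i => i.elim0
  | succ n ih =>
    refine circleIntegral.integral_congr hR fun z hz => ih fun w hw => h _ fun i => ?_
    refine Fin.cases ?_ (fun i => ?_) i
    · simpa using hz
    · simpa using hw i

lemma mcInt_const_mul (R : ℝ) (c : ℂ) (f : (Fin n → ℂ) → ℂ) :
    mcInt n R (fun w => c * f w) = c * mcInt n R f := by
  induction n with
  | zero => rfl
  | succ n ih => simp only [mcInt, ih, circleIntegral.integral_const_mul]

/-- Any one of the integrations may be performed first. -/
lemma mcInt_succ_insertNth {R : ℝ} (k : Fin (n + 1)) {f : (Fin (n + 1) → ℂ) → ℂ}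
    (hf : Continuous fun θ : Fin (n + 1) → ℝ => f fun i => circleMap 0 R (θ i)) :
    mcInt (n + 1) R f = mcInt n R fun w => ∮ z in C(0, R), f (k.insertNth z w) := by
  induction n with
  | zero =>
    obtain rfl : k = 0 := Fin.eq_zero k
    simp only [mcInt, Fin.insertNth_zero']
  | succ n ih =>
    refine Fin.cases ?_ (fun k => ?_) k
    · simp only [Fin.insertNth_zero']
      refine circleIntegral_mcInt_swap R R (f := fun z w => f (Fin.cons z w)) ?_
      have hcons : Continuous fun p : ℝ × (Fin (n + 1) → ℝ) =>
          (Fin.cons p.1 p.2 : Fin (n + 2) → ℝ) := by fun_prop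
      simpa only [cons_circleMap, Function.comp_def] using hf.comp hcons
    · rw [mcInt, mcInt]
      simp only [Fin.insertNth_succ_cons]
      unfold circleIntegral
      refine intervalIntegral.integral_congr fun θ _ => ?_
      have hcons : Continuous fun φ : Fin (n + 1) → ℝ =>
          (Fin.cons θ φ : Fin (n + 2) → ℝ) := by fun_prop
      simp only
      congr 1
      refine ih (f := fun w => f (Fin.cons (circleMap 0 R θ) w)) k ?_
      simpa only [cons_circleMap, Function.comp_def] using hf.comp hcons

lemma circleIntegral_eq_mul_unit (z : ℂ) (f : ℂ → ℂ) :
    (∮ x in C(0, ‖z‖), f x) = z * ∮ u in C(0, 1), f (z * u) := by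
  have hmap (θ : ℝ) : z * circleMap 0 1 θ = circleMap 0 ‖z‖ (θ + z.arg) := by
    nth_rw 1 [← Complex.norm_mul_exp_arg_mul_I z]
    simp only [circleMap, zero_add, Complex.ofReal_one, one_mul, Complex.ofReal_add, add_mul,
      Complex.exp_add]
    ring
  have hper : Function.Periodic
      (fun θ => circleMap 0 ‖z‖ θ * Complex.I * f (circleMap 0 ‖z‖ θ)) (2 * Real.pi) := fun θ => by
    simp only [periodic_circleMap 0 ‖z‖ θ]
  simp only [circleIntegral, deriv_circleMap, smul_eq_mul]
  rw [← intervalIntegral.integral_const_mul]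
  simp only [← mul_assoc, hmap]
  rw [intervalIntegral.integral_comp_add_right
    (fun θ => circleMap 0 ‖z‖ θ * Complex.I * f (circleMap 0 ‖z‖ θ))]
  simpa [add_comm] using hper.intervalIntegral_add_eq 0 z.arg

lemma mcInt_eq_pow_mul_unit (z : ℂ) (f : (Fin n → ℂ) → ℂ) :
    mcInt n ‖z‖ f = z ^ n * mcInt n 1 fun u => f fun i => z * u i := by
  induction n with
  | zero =>
    simp only [mcInt, pow_zero, one_mul]
    congr 1
    ext i
    exact i.elim0
  | succ n ih =>
    simp only [mcInt, ih, circleIntegral.integral_const_mul]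
    rw [circleIntegral_eq_mul_unit, pow_succ, mul_assoc]
    congr 4 with u
    congr 1 with w
    congr 1 with i
    refine Fin.cases ?_ (fun i => ?_) i <;> simp

lemma circleIntegral_eq_of_differentiableAt {r R : ℝ} (hr : 0 < r) (hrR : r ≤ R) {g : ℂ → ℂ}
    (hg : ∀ z, r ≤ ‖z‖ → DifferentiableAt ℂ g z) :
    (∮ z in C(0, R), g z) = ∮ z in C(0, r), g z := by
  refine Complex.circleIntegral_eq_of_differentiable_on_annulus_off_countable hr hrR
    Set.countable_empty (fun z hz => ?_) fun z hz => ?_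
  · exact (hg z (by simpa using hz.2)).continuousAt.continuousWithinAt
  · have : r < ‖z‖ := by simpa using hz.1.2
    exact hg z this.le

/-- Enlarging the common radius of all contours does not change the iterated integral of a
function holomorphic on the tori swept out. -/
lemma mcInt_eq_of_differentiableAt {r R : ℝ} (hr : 0 < r) (hrR : r ≤ R)
    {f : (Fin (n + 1) → ℂ) → ℂ}
    (hf : ∀ w s, r ≤ s → (∀ i, ‖w i‖ = s) → DifferentiableAt ℂ f w) :
    mcInt (n + 1) R f = mcInt (n + 1) r f := by
  have hnorm {z : ℂ} {u : Fin n → ℂ} (hu : ∀ i, ‖u i‖ = 1) (i : Fin (n + 1)) :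
      ‖(Fin.cons z (fun i => z * u i) : Fin (n + 1) → ℂ) i‖ = ‖z‖ := by
    refine Fin.cases ?_ (fun i => ?_) i <;> simp [hu]
  have hcons : Differentiable ℂ fun p : ℂ × (Fin n → ℂ) =>
      (Fin.cons p.1 (fun i => p.1 * p.2 i) : Fin (n + 1) → ℂ) := by
    rw [differentiable_pi]
    refine Fin.cases ?_ fun i => ?_
    · simp only [Fin.cons_zero]; fun_prop
    · simp only [Fin.cons_succ]; fun_prop
  have hdiff (p : ℂ × (Fin n → ℂ)) (hp : r ≤ ‖p.1‖) (hu : ∀ i, ‖p.2 i‖ = 1) :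
      DifferentiableAt ℂ (fun p : ℂ × (Fin n → ℂ) =>
        p.1 ^ n * f (Fin.cons p.1 fun i => p.1 * p.2 i)) p :=
    DifferentiableAt.mul (by fun_prop)
      ((hf _ _ hp (hnorm hu)).comp (f := fun p : ℂ × (Fin n → ℂ) =>
        (Fin.cons p.1 (fun i => p.1 * p.2 i) : Fin (n + 1) → ℂ)) p (hcons p))
  have key (s : ℝ) (hs : r ≤ s) : mcInt (n + 1) s f =
      mcInt n 1 fun u => ∮ z in C(0, s), z ^ n * f (Fin.cons z fun i => z * u i) := by
    rw [← circleIntegral_mcInt_swap]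
    · refine circleIntegral.integral_congr (hr.le.trans hs) fun z hz => ?_
      obtain rfl : ‖z‖ = s := by simpa using hz
      simp only [mcInt_eq_pow_mul_unit, mcInt_const_mul]
    · have hmap : Continuous fun p : ℝ × (Fin n → ℝ) =>
          (circleMap 0 s p.1, fun i => circleMap 0 1 (p.2 i)) := by fun_prop
      refine continuous_iff_continuousAt.2 fun p => ?_
      refine ContinuousAt.comp (f := fun p : ℝ × (Fin n → ℝ) =>
          (circleMap 0 s p.1, fun i => circleMap 0 1 (p.2 i))) (hdiff _ ?_ ?_).continuousAt
        hmap.continuousAt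
      · simpa using hs.trans (le_abs_self s)
      · simp
  rw [key R hrR, key r le_rfl]
  refine mcInt_congr zero_le_one fun u hu => ?_
  refine circleIntegral_eq_of_differentiableAt hr hrR fun z hz => ?_
  exact (hdiff (z, u) hz hu).comp (f := fun z : ℂ => (z, u)) z (by fun_prop)

/-- A residue at infinity. -/
lemma circleIntegral_eq_of_tendsto {R : ℝ} (hR : 0 < R) {g : ℂ → ℂ} {c : ℂ}
    (hg : ∀ z, R ≤ ‖z‖ → DifferentiableAt ℂ g z)
    (hlim : Filter.Tendsto (fun z => z * g z) (Bornology.cobounded ℂ) (nhds c)) :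
    (∮ z in C(0, R), g z) = 2 * Real.pi * Complex.I * c := by
  rw [← sub_eq_zero, ← norm_le_zero_iff]
  refine le_of_forall_pos_le_add fun ε hε => ?_
  have hδ : 0 < ε / (2 * Real.pi) := by positivity
  have hev := Metric.tendsto_nhds.1 hlim _ hδ
  obtain ⟨M, -, hM⟩ := (Filter.HasBasis.eventually_iff
    (Metric.hasBasis_cobounded_compl_closedBall (0 : ℂ))).1 hev
  obtain ⟨S, hRS, hMS⟩ : ∃ S, R ≤ S ∧ M < S := ⟨max R (M + 1), le_max_left _ _, by simp⟩
  have hS : 0 < S := hR.trans_le hRS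
  have hne : ∀ z ∈ Metric.sphere (0 : ℂ) S, z ≠ 0 := fun z hz h => by
    simp [h] at hz; exact hS.ne hz
  have hc : (∮ z in C(0, S), c * z⁻¹) = 2 * Real.pi * Complex.I * c := by
    have := circleIntegral.integral_sub_center_inv 0 hS.ne'
    simp only [sub_zero] at this
    rw [circleIntegral.integral_const_mul, this, mul_comm]
  rw [← circleIntegral_eq_of_differentiableAt hR hRS hg, ← hc, ← circleIntegral.integral_sub]
  · refine (circleIntegral.norm_integral_le_of_norm_le_const (C := ε / (2 * Real.pi) / S) hS.le
      fun z hz => ?_).trans_eq ?_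
    · have hzS : ‖z‖ = S := by simpa using hz
      have h : dist (z * g z) c < _ := hM (by simpa [hzS] using hMS)
      have hz0 := hne z hz
      have : g z - c * z⁻¹ = (z * g z - c) / z := by field_simp
      rw [this, norm_div, hzS, ← dist_eq_norm]
      gcongr
    · field_simp
      simp
  · refine ContinuousOn.circleIntegrable hS.le fun z hz => ?_
    refine (hg z ?_).continuousAt.continuousWithinAt
    simpa [show ‖z‖ = S by simpa using hz] using hRS
  · exact ContinuousOn.circleIntegrable hS.le
      (continuousOn_const.mul (continuousOn_id.inv₀ hne))

end ContourIntegral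

section Scattering

open Filter Bornology

lemma tendsto_inv_const_sub_cobounded (c : ℂ) :
    Tendsto (fun z => (c - z)⁻¹) (cobounded ℂ) (nhds 0) := by
  exact tendsto_inv₀_cobounded.comp (by simp)

lemma circleIntegral_scattering {ι : Type*} (s : Finset ι) {q R : ℝ} (hq0 : 0 < q) (hq1 : q < 1)
    {b : ℂ} (hb : ‖b‖ < R) {w : ι → ℂ} (hw : ∀ i, ‖w i‖ = R) :
    (∮ z in C(0, R), b / (b - z) * ∏ i ∈ s, (-((q : ℂ) * z - w i) / ((q : ℂ) * w i - z))) =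
      2 * Real.pi * Complex.I * (-b * (q : ℂ) ^ s.card) := by
  have hR : 0 < R := (norm_nonneg b).trans_lt hb
  refine circleIntegral_eq_of_tendsto hR (fun z hz => ?_) ?_
  · refine DifferentiableAt.mul ?_ (DifferentiableAt.fun_finsetProd fun i _ => ?_)
    · refine DifferentiableAt.div (by fun_prop) (by fun_prop) (sub_ne_zero.2 fun h => ?_)
      exact (hb.trans_le hz).ne (by rw [h])
    · refine DifferentiableAt.div (by fun_prop) (by fun_prop) (sub_ne_zero.2 fun h => ?_)
      have : q * R = ‖z‖ := by rw [← h, norm_mul, hw, Complex.norm_real, Real.norm_of_nonneg hq0.le]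
      nlinarith
  · have hpole : Tendsto (fun z => z * (b / (b - z))) (cobounded ℂ) (nhds (-b)) := by
      have h : Tendsto (fun z => -b + b ^ 2 * (b - z)⁻¹) (cobounded ℂ) (nhds (-b + b ^ 2 * 0)) :=
        tendsto_const_nhds.add (tendsto_const_nhds.mul (tendsto_inv_const_sub_cobounded b))
      rw [mul_zero, add_zero] at h
      refine h.congr' ?_
      filter_upwards [eventually_ne_cobounded b] with z hz
      have := sub_ne_zero.2 hz.symm
      field_simp
      ring
    have hfactor (i : ι) : Tendsto (fun z => -((q : ℂ) * z - w i) / ((q : ℂ) * w i - z))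
        (cobounded ℂ) (nhds (q : ℂ)) := by
      have h : Tendsto (fun z => (q : ℂ) + (w i - q ^ 2 * w i) * (q * w i - z)⁻¹) (cobounded ℂ)
          (nhds (q + (w i - q ^ 2 * w i) * 0)) :=
        tendsto_const_nhds.add (tendsto_const_nhds.mul (tendsto_inv_const_sub_cobounded _))
      rw [mul_zero, add_zero] at h
      refine h.congr' ?_
      filter_upwards [eventually_ne_cobounded ((q : ℂ) * w i)] with z hz
      have := sub_ne_zero.2 hz.symm
      field_simp
      ring
    have h := hpole.mul (tendsto_finsetProd s fun i _ => hfactor i)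
    simpa only [Finset.prod_const, mul_assoc] using h

end Scattering

section Integrand

variable {n : ℕ} {q : ℝ} {b : ℤ → ℝ}

/-- The integrand of `Lam` at time `0`. -/
noncomputable def lamIntegrand (q : ℝ) (b : ℤ → ℝ) (Y X : Fin n → ℤ)
    (σ : Equiv.Perm (Fin n)) (w : Fin n → ℂ) : ℂ :=
  Acoef q σ w * ∏ j, eprod (fun k => (b k : ℂ) / ((b k : ℂ) - w (σ j))) (Y (σ j)) (X j)

lemma Lam_zero (Y X : Fin n → ℤ) (σ : Equiv.Perm (Fin n)) (R : ℝ) :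
    Lam q b Y X 0 σ R = (∏ k, (-1 : ℂ) / (b (X k) : ℂ)) *
      (1 / (2 * Real.pi * Complex.I)) ^ n * mcInt n R (lamIntegrand q b Y X σ) := by
  unfold Lam lamIntegrand
  simp

lemma differentiableAt_prod {ι E : Type*} [NormedAddCommGroup E] [NormedSpace ℂ E]
    {s : Finset ι} {f : ι → E → ℂ} {w : E} (hf : ∀ i ∈ s, DifferentiableAt ℂ (f i) w) :
    DifferentiableAt ℂ (fun w => ∏ i ∈ s, f i w) w := by
  classical
  exact (HasFDerivAt.finsetProd fun i hi => (hf i hi).hasFDerivAt).differentiableAt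

lemma DifferentiableAt.eprod {E : Type*} [NormedAddCommGroup E] [NormedSpace ℂ E]
    {f : ℤ → E → ℂ} {m l : ℤ} {w : E}
    (hf : ∀ k, min m (l + 1) ≤ k → k ≤ max l (m - 1) → DifferentiableAt ℂ (f k) w ∧ f k w ≠ 0) :
    DifferentiableAt ℂ (fun w => eprod (fun k => f k w) m l) w := by
  unfold _root_.eprod
  split_ifs
  · refine differentiableAt_prod fun k hk => ?_
    rw [Finset.mem_Icc] at hk
    exact (hf k (min_le_of_left_le hk.1) (le_max_of_le_left hk.2)).1
  · refine differentiableAt_prod fun k hk => ?_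
    rw [Finset.mem_Icc] at hk
    obtain ⟨hd, h0⟩ := hf k (min_le_of_right_le hk.1) (le_max_of_le_right hk.2)
    exact hd.fun_inv h0

lemma ValidR.mono {X Y : Fin n → ℤ} {R S : ℝ} (h : ValidR b X Y R) (hRS : R ≤ S) :
    ValidR b X Y S := fun k h₁ h₂ => (h k h₁ h₂).trans_le hRS

lemma ValidR.lt {X Y : Fin n → ℤ} {R : ℝ} (h : ValidR b X Y R) (j : Fin n) : b (X j) < R :=
  h _ ⟨j, by have := min_le_left (X j) (Y j); omega⟩ ⟨j, le_max_left _ _⟩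

lemma ValidR.tail {X Y : Fin (n + 1) → ℤ} {R : ℝ} (h : ValidR b X Y R) :
    ValidR b (X ∘ Fin.succ) (Y ∘ Fin.succ) R :=
  fun k ⟨i, hi⟩ ⟨j, hj⟩ => h k ⟨i.succ, hi⟩ ⟨j.succ, hj⟩

lemma lamIntegrand_differentiableAt (hq0 : 0 < q) (hq1 : q < 1) (hb : ∀ i, 0 < b i)
    {X Y : Fin n → ℤ} (σ : Equiv.Perm (Fin n)) {R : ℝ} (hR : ValidR b X Y R) {w : Fin n → ℂ}
    (hw : ∀ i, ‖w i‖ = R) : DifferentiableAt ℂ (lamIntegrand q b Y X σ) w := by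
  have hpole (i : Fin n) (k : ℤ) (hk : b k < R) : (b k : ℂ) - w i ≠ 0 := fun h => by
    have := congrArg norm (sub_eq_zero.1 h)
    rw [hw, Complex.norm_real, Real.norm_of_nonneg (hb k).le] at this
    exact hk.ne this
  refine DifferentiableAt.mul (differentiableAt_prod fun p _ => ?_)
    (differentiableAt_prod fun j _ => DifferentiableAt.eprod fun k hk₁ hk₂ => ?_)
  · suffices h : (q : ℂ) * w p.2 - w p.1 ≠ 0 by fun_prop (disch := exact h)
    refine sub_ne_zero.2 fun h => ?_
    have hqR : q * R = R := by
      have := congrArg norm h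
      rwa [norm_mul, Complex.norm_real, Real.norm_of_nonneg hq0.le, hw, hw] at this
    have : b (X p.1) < R := hR.lt p.1
    have := hb (X p.1)
    nlinarith
  · have hk : b k < R := by
      refine hR k ?_ ?_
      · rcases min_le_iff.1 hk₁ with h | h
        · exact ⟨σ j, by have := min_le_right (X (σ j)) (Y (σ j)); omega⟩
        · exact ⟨j, by have := min_le_left (X j) (Y j); omega⟩
      · rcases le_max_iff.1 hk₂ with h | h
        · exact ⟨j, le_max_of_le_left h⟩
        · exact ⟨σ j, by have := le_max_right (X (σ j)) (Y (σ j)); omega⟩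
    have h0 := hpole (σ j) k hk
    exact ⟨by fun_prop (disch := exact h0),
      div_ne_zero (by exact_mod_cast (hb k).ne') h0⟩

lemma mcInt_lamIntegrand_eq (hq0 : 0 < q) (hq1 : q < 1) (hb : ∀ i, 0 < b i)
    {X Y : Fin (n + 1) → ℤ} (σ : Equiv.Perm (Fin (n + 1))) {R R' : ℝ} (hR : ValidR b X Y R)
    (hR' : ValidR b X Y R') :
    mcInt (n + 1) R (lamIntegrand q b Y X σ) = mcInt (n + 1) R' (lamIntegrand q b Y X σ) := by
  wlog h : R' ≤ R generalizing R R'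
  · exact (this hR' hR (le_of_not_ge h)).symm
  refine mcInt_eq_of_differentiableAt ((hb _).trans (hR'.lt 0)) h fun w s hs hw => ?_
  exact lamIntegrand_differentiableAt hq0 hq1 hb σ (hR'.mono hs) hw

lemma Acoef_eq_prod (σ : Equiv.Perm (Fin n)) (w : Fin n → ℂ) :
    Acoef q σ w = ∏ β, ∏ α, if α < β ∧ σ⁻¹ β < σ⁻¹ α then
      (-((q : ℂ) * w β - w α) / ((q : ℂ) * w α - w β)) else 1 := by
  rw [Acoef, Finset.prod_filter, ← Finset.univ_product_univ, Finset.prod_product]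

variable {k : Fin (n + 1)} {σ : Equiv.Perm (Fin (n + 1))} {τ : Equiv.Perm (Fin n)}

lemma Acoef_insertNth (hσ : σ 0 = k) (hτ : ∀ i, σ i.succ = k.succAbove (τ i)) (z : ℂ)
    (w : Fin n → ℂ) :
    Acoef q σ (k.insertNth z w) =
      (∏ i with i.castSucc < k, (-((q : ℂ) * z - w i) / ((q : ℂ) * w i - z))) * Acoef q τ w := by
  have hk : σ⁻¹ k = 0 := by rw [Equiv.Perm.inv_eq_iff_eq, hσ]
  have hs (i : Fin n) : σ⁻¹ (k.succAbove i) = (τ⁻¹ i).succ := by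
    rw [Equiv.Perm.inv_eq_iff_eq, hτ]; simp
  rw [Acoef_eq_prod, Acoef_eq_prod, Fin.prod_univ_succAbove _ k, Finset.prod_filter]
  congr 1
  · rw [Fin.prod_univ_succAbove _ k]
    simp [hk, hs, Fin.succAbove_lt_iff_castSucc_lt]
  · refine Finset.prod_congr rfl fun i _ => ?_
    rw [Fin.prod_univ_succAbove _ k]
    simp [hk, hs]

lemma lamIntegrand_insertNth {X Y : Fin (n + 1) → ℤ} (hσ : σ 0 = k)
    (hτ : ∀ i, σ i.succ = k.succAbove (τ i)) (hinit : ∀ j ≤ k, Y j = X 0) (z : ℂ)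
    (w : Fin n → ℂ) :
    lamIntegrand q b Y X σ (k.insertNth z w) =
      lamIntegrand q b (Y ∘ Fin.succ) (X ∘ Fin.succ) τ w * ((b (X 0) : ℂ) / (b (X 0) - z) *
        ∏ i with i.castSucc < k, (-((q : ℂ) * z - w i) / ((q : ℂ) * w i - z))) := by
  have hY (i : Fin n) : Y (k.succAbove i) = Y i.succ := by
    rcases lt_or_ge i.castSucc k with h | h
    · rw [Fin.succAbove_of_castSucc_lt _ _ h, hinit _ h.le, hinit _ (Fin.castSucc_lt_iff_succ_le.1 h)]
    · rw [Fin.succAbove_of_le_castSucc _ _ h]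
  rw [lamIntegrand, Acoef_insertNth hσ hτ, Fin.prod_univ_succ]
  simp only [hσ, hτ, hY, hinit k le_rfl, Fin.insertNth_apply_same, Fin.insertNth_apply_succAbove]
  simp only [lamIntegrand, Function.comp_apply]
  rw [show eprod (fun k => (b k : ℂ) / ((b k : ℂ) - z)) (X 0) (X 0) =
    (b (X 0) : ℂ) / (b (X 0) - z) by simp [eprod]]
  ring

lemma card_castSucc_lt (k : Fin (n + 1)) : ({i : Fin n | i.castSucc < k} : Finset _).card = k := by
  simp only [Fin.lt_def, Fin.val_castSucc, Fin.card_filter_val_lt]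
  exact min_eq_right (Nat.lt_succ_iff.1 k.is_lt)

end Integrand

/-- reduction of `Λ_Y(X;0;σ)` to the `(n-1)`-particle quantity
when `σ(1) = k` and `x_1 = y_1 = ⋯ = y_k`. -/
theorem lam_reduction
    (q : ℝ) (hq : q ∈ Set.Ioo (0 : ℝ) 1) (a b : ℤ → ℝ)
    (ha : ∀ i, 0 < a i) (hb : ∀ i, b i = a i * (1 - q))
    (n : ℕ) (X Y : Fin (n + 2) → ℤ) (hX : Antitone X) (hY : Antitone Y)
    (k : Fin (n + 2)) (σ : Equiv.Perm (Fin (n + 2))) (hσ : σ 0 = k)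
    (τ : Equiv.Perm (Fin (n + 1)))
    (hτ : ∀ i : Fin (n + 1), (τ i : ℕ) =
      if (σ i.succ : ℕ) < (k : ℕ) then (σ i.succ : ℕ) else (σ i.succ : ℕ) - 1)
    (hinit : ∀ j : Fin (n + 2), j ≤ k → Y j = X 0)
    (R R' : ℝ) (hR : ValidR b X Y R) (hR' : ValidR b (X ∘ Fin.succ) (Y ∘ Fin.succ) R') :
    Lam q b Y X 0 σ R =
      (q : ℂ) ^ (k : ℕ) * Lam q b (Y ∘ Fin.succ) (X ∘ Fin.succ) 0 τ R' := by
  obtain ⟨hq0, hq1⟩ := hq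
  have hbpos (i : ℤ) : 0 < b i := by
    rw [hb]; exact mul_pos (ha i) (sub_pos.2 hq1)
  have hτ' (i : Fin (n + 1)) : σ i.succ = k.succAbove (τ i) := by
    have hne : σ i.succ ≠ k := fun h => Fin.succ_ne_zero i (σ.injective (h.trans hσ.symm))
    have hne' : (σ i.succ : ℕ) ≠ k := Fin.val_ne_of_ne hne
    have h := hτ i
    ext
    simp only [Fin.succAbove, Fin.lt_def, Fin.val_castSucc]
    split_ifs at h ⊢ <;> simp only [Fin.val_castSucc, Fin.val_succ] <;> omega
  have hmap : Continuous fun θ : Fin (n + 2) → ℝ => fun i => circleMap 0 R (θ i) := by fun_prop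
  have hcont : Continuous fun θ : Fin (n + 2) → ℝ =>
      lamIntegrand q b Y X σ fun i => circleMap 0 R (θ i) := by
    refine continuous_iff_continuousAt.2 fun θ => ?_
    refine ContinuousAt.comp (f := fun θ : Fin (n + 2) → ℝ => fun i => circleMap 0 R (θ i))
      (lamIntegrand_differentiableAt hq0 hq1 hbpos σ hR fun i => ?_).continuousAt hmap.continuousAt
    simpa using ((hbpos _).trans (hR.lt 0)).le
  have hb0 : ‖(b (X 0) : ℂ)‖ < R := by
    rw [Complex.norm_real, Real.norm_of_nonneg (hbpos _).le]
    exact hR.lt 0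
  have hint : mcInt (n + 2) R (lamIntegrand q b Y X σ) =
      2 * Real.pi * Complex.I * (-b (X 0) * (q : ℂ) ^ (k : ℕ)) *
        mcInt (n + 1) R' (lamIntegrand q b (Y ∘ Fin.succ) (X ∘ Fin.succ) τ) := by
    rw [mcInt_succ_insertNth k hcont, mcInt_lamIntegrand_eq hq0 hq1 hbpos τ hR' hR.tail,
      ← mcInt_const_mul]
    refine mcInt_congr ((norm_nonneg _).trans hb0.le) fun w hw => ?_
    simp only [lamIntegrand_insertNth hσ hτ' hinit, circleIntegral.integral_const_mul]
    rw [circleIntegral_scattering _ hq0 hq1 hb0 hw, card_castSucc_lt, mul_comm]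
  have h0 : (b (X 0) : ℂ) ≠ 0 := by exact_mod_cast (hbpos _).ne'
  rw [Lam_zero, Lam_zero, hint, Fin.prod_univ_succ, pow_succ]
  simp only [Function.comp_apply]
  field_simp
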